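/- Let h ∈ ℕ and let Y = (Y_1^{(1)},…,Y_h^{(1)},Y_1^{(2)},…,Y_h^{(2)}) be an integrable ℝ^{2h}-valued random vector such that −Y has the same distribution as Y and such that, almost surely, for each p ∈ {1,2} the h+1 numbers 0, Y_1^{(p)}, Y_1^{(p)}+Y_2^{(p)}, …, Y_1^{(p)}+⋯+Y_h^{(p)} are pairwise distinct. Then for every coordinate index i ∈ {1,…,2h} and every π ∈ S_h, E[Y^{(i)}·1{Π̃(Y_1^{(1)},…,Y_h^{(1)}) = Π̃(Y_1^{(2)},…,Y_h^{(2)}) = π}] = −E[Y^{(i)}·1{Π̃(Y_1^{(1)},…,Y_h^{(1)}) = Π̃(Y_1^{(2)},…,Y_h^{(2)}) = S(π)}], where S(π_0,…,π_h) := (π_h,…,π_0) is the spatial reversal. -/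

import Mathlib

open MeasureTheory

/-- `π` is the ordinal pattern of `x = (x_0,…,x_m)`: the values `x_{π_0} ≥ … ≥ x_{π_m}` are
ordered decreasingly, with ties broken by `π_{i−1} < π_i` whenever `x_{π_{i−1}} = x_{π_i}`. -/
def IsOrdPat {m : ℕ} (x : Fin (m + 1) → ℝ) (π : Equiv.Perm (Fin (m + 1))) : Prop :=
  (∀ i : Fin m, x (π i.succ) ≤ x (π i.castSucc)) ∧
  (∀ i : Fin m, x (π i.castSucc) = x (π i.succ) → π i.castSucc < π i.succ)

/-- The vector of partial sums `(0, y_1, y_1+y_2, …, y_1+⋯+y_m)` of `y = (y_1,…,y_m)`;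
the map `Π̃` of the paper is `y ↦ Π(cumsum y)`. -/
def cumsum (m : ℕ) (y : Fin m → ℝ) : Fin (m + 1) → ℝ :=
  fun i => ∑ j : Fin m, if (j : ℕ) < (i : ℕ) then y j else 0

/-- The spatial reversal `S(π_0,…,π_h) := (π_h,…,π_0)`, i.e. `S(π) i = π (h − i)`. -/
def spatialRev {m : ℕ} (π : Equiv.Perm (Fin (m + 1))) : Equiv.Perm (Fin (m + 1)) :=
  Fin.revPerm.trans π

lemma ordPat_eq_iff_strictAnti {m : ℕ} {x : Fin (m + 1) → ℝ} (hx : Function.Injective x)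
    {σ : Equiv.Perm (Fin (m + 1))} (hσ : IsOrdPat x σ) (π : Equiv.Perm (Fin (m + 1))) :
    σ = π ↔ StrictAnti (x ∘ π) := by
  have hσ' : StrictAnti (x ∘ σ) := Fin.strictAnti_iff_succ_lt.2 fun i =>
    (hσ.1 i).lt_of_ne fun e => Fin.castSucc_lt_succ.ne' (σ.injective (hx e))
  refine ⟨fun e => e ▸ hσ', fun hπ => ?_⟩
  have hr : Set.range (fun i => -(x ∘ σ) i) = Set.range (fun i => -(x ∘ π) i) := by
    have key (τ : Equiv.Perm (Fin (m + 1))) :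
        Set.range (fun i => -(x ∘ τ) i) = Set.range (fun i => -x i) :=
      τ.surjective.range_comp (fun i => -x i)
    rw [key, key]
  have he := (StrictMono.range_inj hσ'.neg hπ.neg).1 hr
  ext1 i
  exact hx (neg_injective (congrFun he i))

lemma cumsum_neg (m : ℕ) (y : Fin m → ℝ) : cumsum m (-y) = -cumsum m y := by
  ext i
  simp only [cumsum, Pi.neg_apply, ← Finset.sum_neg_distrib]
  exact Finset.sum_congr rfl fun j _ => by split_ifs <;> simp

lemma measurable_cumsum (m : ℕ) : Measurable (cumsum m) := by
  refine measurable_pi_lambda _ fun i => Finset.measurable_fun_sum _ fun j _ => ?_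
  split_ifs
  · exact measurable_pi_apply j
  · exact measurable_const

lemma strictAnti_neg_comp_iff_spatialRev {m : ℕ} (x : Fin (m + 1) → ℝ)
    (π : Equiv.Perm (Fin (m + 1))) :
    StrictAnti ((-x) ∘ π) ↔ StrictAnti (x ∘ spatialRev π) := by
  constructor
  · intro hx a b hab
    exact neg_lt_neg_iff.1 (hx (Fin.rev_lt_rev.2 hab))
  · intro hx a b hab
    have := hx (Fin.rev_lt_rev.2 hab)
    simpa [spatialRev] using this

/-- The vectors whose two blocks both have partial sums strictly decreasing along `π`. -/
def commonPatternSet (h : ℕ) (π : Equiv.Perm (Fin (h + 1))) : Set (Fin 2 → Fin h → ℝ) :=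
  {y | StrictAnti (cumsum h (y 0) ∘ π) ∧ StrictAnti (cumsum h (y 1) ∘ π)}

lemma measurableSet_commonPatternSet (h : ℕ) (π : Equiv.Perm (Fin (h + 1))) :
    MeasurableSet (commonPatternSet h π) := by
  have key (q : Fin 2) :
      MeasurableSet {y : Fin 2 → Fin h → ℝ | StrictAnti (cumsum h (y q) ∘ π)} := by
    have hm (a : Fin (h + 1)) :
        Measurable fun y : Fin 2 → Fin h → ℝ => cumsum h (y q) a :=
      (measurable_pi_apply a).comp ((measurable_cumsum h).comp (measurable_pi_apply q))
    simp only [Fin.strictAnti_iff_succ_lt, Set.ofPred_forall, Function.comp_apply]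
    exact MeasurableSet.iInter fun i => measurableSet_lt (hm _) (hm _)
  exact (key 0).inter (key 1)

lemma neg_mem_commonPatternSet_iff {h : ℕ} (π : Equiv.Perm (Fin (h + 1)))
    (y : Fin 2 → Fin h → ℝ) :
    -y ∈ commonPatternSet h π ↔ y ∈ commonPatternSet h (spatialRev π) := by
  simp only [commonPatternSet, Set.mem_ofPred_eq, Pi.neg_apply, cumsum_neg,
    strictAnti_neg_comp_iff_spatialRev]

/-- let `Y = (Y_1^{(1)},…,Y_h^{(1)},Y_1^{(2)},…,Y_h^{(2)})` be an integrable
random vector with `−Y ≅ Y` in distribution, whose two blocks a.s. have tie-free partial-sum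
vectors.  Then for every coordinate `Y^{(i)}` of `Y` and every pattern `π ∈ S_h`,
`E[Y^{(i)}·1{Π̃(Y^{(1)}) = Π̃(Y^{(2)}) = π}] = −E[Y^{(i)}·1{Π̃(Y^{(1)}) = Π̃(Y^{(2)}) = S(π)}]`.
`Pat` is the ordinal pattern map `Π`, characterized by `hPat`, and `Π̃ y = Pat (cumsum y)`. -/
theorem pattern_indicator_first_moment_antisymmetric
    {Ω : Type*} [MeasurableSpace Ω] (P : Measure Ω) [IsProbabilityMeasure P]
    (Pat : ∀ m : ℕ, (Fin (m + 1) → ℝ) → Equiv.Perm (Fin (m + 1)))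
    (hPat : ∀ (m : ℕ) (x : Fin (m + 1) → ℝ), IsOrdPat x (Pat m x))
    (h : ℕ) (Y : Ω → Fin 2 → Fin h → ℝ)
    (hmeas : Measurable Y)
    (hint : ∀ (p : Fin 2) (i : Fin h), Integrable (fun ω => Y ω p i) P)
    (hsym : Measure.map (fun ω => -(Y ω)) P = Measure.map Y P)
    (hties : ∀ᵐ ω ∂P, ∀ p : Fin 2, Function.Injective (cumsum h (Y ω p)))
    (p : Fin 2) (i : Fin h) (π : Equiv.Perm (Fin (h + 1))) :
    ∫ ω, (if Pat h (cumsum h (Y ω 0)) = π ∧ Pat h (cumsum h (Y ω 1)) = π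
        then Y ω p i else 0) ∂P
      = - ∫ ω, (if Pat h (cumsum h (Y ω 0)) = spatialRev π ∧
          Pat h (cumsum h (Y ω 1)) = spatialRev π then Y ω p i else 0) ∂P := by
  have hae (τ : Equiv.Perm (Fin (h + 1))) :
      ∫ ω, (if Pat h (cumsum h (Y ω 0)) = τ ∧ Pat h (cumsum h (Y ω 1)) = τ
        then Y ω p i else 0) ∂P
      = ∫ ω, (commonPatternSet h τ).indicator (fun y => y p i) (Y ω) ∂P := by
    classical
    refine integral_congr_ae ?_
    filter_upwards [hties] with ω hω
    simp only [Set.indicator_apply, commonPatternSet, Set.mem_ofPred_eq,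
      ordPat_eq_iff_strictAnti (hω _) (hPat h _)]
  have hf : StronglyMeasurable
      ((commonPatternSet h π).indicator fun y : Fin 2 → Fin h → ℝ => y p i) :=
    ((by fun_prop : Measurable fun y : Fin 2 → Fin h → ℝ => y p i).indicator
      (measurableSet_commonPatternSet h π)).stronglyMeasurable
  rw [hae, hae, ← integral_map hmeas.aemeasurable hf.aestronglyMeasurable, ← hsym,
    integral_map (φ := fun ω => -Y ω) hmeas.neg.aemeasurable hf.aestronglyMeasurable, ← integral_neg]
  refine integral_congr_ae (.of_forall fun ω => ?_)
  classical
  simp only [Set.indicator_apply, neg_mem_commonPatternSet_iff]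
  split_ifs <;> simp
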